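/- Let 𝔽 be a field and F = F_d + F_{d−γ₁} + ⋯ + F_{d−γ_m} ∈ 𝔽[X₁,…,Xₙ], where F_d and each F_{d−γ_i} are nonzero homogeneous polynomials of degrees d = deg F and d−γ_i respectively, with 0 < γ₁ < ⋯ < γ_m ≤ d, and these are all the nonzero homogeneous components of F. Let k ∈ {1, …, m} be such that γ_k ∉ span_ℕ{γ₁, …, γ_{k−1}} and F_d and F_{d−γ_k} have no common nonconstant factor. If F_d is squarefree and P is a nonconstant polynomial dividing F, then deg P ≥ γ_k. -/

import Mathlib

open MvPolynomial

noncomputable def gradHom (n : ℕ) (K : Type*) [Field K] :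
    MvPolynomial (Fin n) K →ₐ[K] Polynomial (MvPolynomial (Fin n) K) :=
  aeval (fun i => Polynomial.monomial 1 (X i))

theorem gradHom_monomial {n : ℕ} {K : Type*} [Field K] (s : Fin n →₀ ℕ) (c : K) :
    gradHom n K (monomial s c) = Polynomial.monomial s.degree (monomial s c) := by
  have h : ∀ t : Finset (Fin n), (∏ i ∈ t, (Polynomial.monomial 1 (X i : MvPolynomial (Fin n) K)) ^ s i)
      = Polynomial.monomial (∑ i ∈ t, s i) (∏ i ∈ t, (X i : MvPolynomial (Fin n) K) ^ s i) := by
    intro t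
    induction t using Finset.induction_on with
    | empty => simp
    | insert a t ha ih =>
      rw [Finset.prod_insert ha, Finset.prod_insert ha, Finset.sum_insert ha, ih,
        Polynomial.monomial_pow, Polynomial.monomial_mul_monomial, one_mul]
  rw [gradHom, aeval_monomial, Finsupp.prod, h, monomial_eq (s := s) (a := c), Finsupp.prod,
    Finsupp.degree_apply]
  rw [← Polynomial.C_mul_monomial]
  rfl

theorem gradHom_coeff {n : ℕ} {K : Type*} [Field K] (P : MvPolynomial (Fin n) K) (j : ℕ) :
    (gradHom n K P).coeff j = homogeneousComponent j P := by
  induction P using MvPolynomial.induction_on' with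
  | monomial s c =>
    rw [gradHom_monomial, Polynomial.coeff_monomial]
    split_ifs with h
    · exact (homogeneousComponent_of_mem (isHomogeneous_monomial c h) |>.trans (by simp)).symm
    · rw [homogeneousComponent_of_mem (isHomogeneous_monomial c rfl), if_neg (fun h' => h h'.symm)]
  | add p q hp hq => simp [hp, hq]

/-- component of degree `totalDegree - i` -/
noncomputable def topComp {n : ℕ} {K : Type*} [Field K] (P : MvPolynomial (Fin n) K) (i : ℕ) :
    MvPolynomial (Fin n) K :=
  ((gradHom n K P).reflect P.totalDegree).coeff i

theorem topComp_le {n : ℕ} {K : Type*} [Field K] (P : MvPolynomial (Fin n) K) (i : ℕ)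
    (h : i ≤ P.totalDegree) : topComp P i = homogeneousComponent (P.totalDegree - i) P := by
  rw [topComp, Polynomial.coeff_reflect, Polynomial.revAt_le h, gradHom_coeff]

theorem topComp_gt {n : ℕ} {K : Type*} [Field K] (P : MvPolynomial (Fin n) K) (i : ℕ)
    (h : P.totalDegree < i) : topComp P i = 0 := by
  rw [topComp, Polynomial.coeff_reflect, Polynomial.revAt_eq_self_of_lt h, gradHom_coeff]
  exact homogeneousComponent_eq_zero _ _ h

theorem topComp_mul {n : ℕ} {K : Type*} [Field K] (P Q : MvPolynomial (Fin n) K) (hP : P ≠ 0)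
    (hQ : Q ≠ 0) (i : ℕ) :
    topComp (P * Q) i = ∑ x ∈ Finset.HasAntidiagonal.antidiagonal i, topComp P x.1 * topComp Q x.2 := by
  have hd (P : MvPolynomial (Fin n) K) : (gradHom n K P).natDegree ≤ P.totalDegree := by
    rw [Polynomial.natDegree_le_iff_coeff_eq_zero]
    intro N hN
    rw [gradHom_coeff]
    exact homogeneousComponent_eq_zero _ _ hN
  unfold topComp
  rw [map_mul, totalDegree_mul_of_isDomain hP hQ, Polynomial.reflect_mul _ _ (hd P) (hd Q),
    Polynomial.coeff_mul]

theorem topComp_eq_zero {n : ℕ} {K : Type*} [Field K] (P : MvPolynomial (Fin n) K) (i : ℕ)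
    (hi : 0 < i) (h0 : topComp P 0 ≠ 0) (h : topComp P 0 ∣ topComp P i) : topComp P i = 0 := by
  by_contra hne
  have hle : i ≤ P.totalDegree := by
    by_contra hc
    exact hne (topComp_gt P i (by omega))
  obtain ⟨c, hc⟩ := h
  have hc0 : c ≠ 0 := by rintro rfl; simp at hc; exact hne hc
  have h1 : (topComp P i).totalDegree = P.totalDegree - i := by
    have := homogeneousComponent_isHomogeneous (P.totalDegree - i) P
    rw [← topComp_le P i hle] at this
    exact this.totalDegree hne
  have h2 : (topComp P 0).totalDegree = P.totalDegree := by
    have := homogeneousComponent_isHomogeneous (P.totalDegree - 0) P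
    rw [← topComp_le P 0 (Nat.zero_le _)] at this
    exact this.totalDegree h0
  have := congrArg totalDegree hc
  rw [totalDegree_mul_of_isDomain h0 hc0, h1, h2] at this
  omega



/-- If `γ_k ∉ span_ℕ{γ₁, …, γ_{k−1}}`, the forms `F_d` and `F_{d−γ_k}` have no common
nonconstant factor, and `F_d` is squarefree, then every nonconstant divisor `P` of `F`
satisfies `deg P ≥ γ_k`. -/
theorem totalDegree_ge_gap_of_dvd {n m : ℕ} {𝔽 : Type*} [Field 𝔽]
    (F Fd : MvPolynomial (Fin n) 𝔽) (G : Fin (m + 1) → MvPolynomial (Fin n) 𝔽)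
    (d : ℕ) (γ : Fin (m + 1) → ℕ)
    (hF : F = Fd + ∑ i, G i)
    (hdeg : F.totalDegree = d)
    (hFd : Fd.IsHomogeneous d) (hFd0 : Fd ≠ 0)
    (hG : ∀ i, (G i).IsHomogeneous (d - γ i)) (hG0 : ∀ i, G i ≠ 0)
    (hpos : 0 < γ 0) (hmono : StrictMono γ) (hle : γ (Fin.last m) ≤ d)
    (k : Fin (m + 1))
    (hspan : γ k ∉ AddSubmonoid.closure (γ '' {j | j < k}))
    (hrp : ∀ D : MvPolynomial (Fin n) 𝔽, D ∣ Fd → D ∣ G k → IsUnit D)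
    (hsf : Squarefree Fd) :
    ∀ P : MvPolynomial (Fin n) 𝔽, P.totalDegree ≠ 0 → P ∣ F → γ k ≤ P.totalDegree := by
  intro P hP0 hPF
  obtain ⟨Q, hQ⟩ := hPF
  by_contra hlt
  push Not at hlt
  have hγpos : ∀ i, 0 < γ i := fun i => lt_of_lt_of_le hpos (hmono.monotone (Fin.zero_le i))
  have hγd : ∀ i, γ i ≤ d := fun i => le_trans (hmono.monotone (Fin.le_last i)) hle
  -- components of F
  have hcomp : ∀ i ≤ d, topComp F i = (if i = 0 then Fd else 0) + ∑ j, if γ j = i then G j else 0 := by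
    intro i hi
    rw [topComp_le F i (hdeg ▸ hi), hdeg]
    conv_lhs => rw [hF]
    rw [map_add, map_sum, homogeneousComponent_of_mem hFd]
    congr 1
    · congr 1
      apply propext
      omega
    · refine Finset.sum_congr rfl fun j _ => ?_
      rw [homogeneousComponent_of_mem (hG j)]
      congr 1
      apply propext
      have := hγd j
      omega
  have hF0 : topComp F 0 = Fd := by
    rw [hcomp 0 (Nat.zero_le _), if_pos rfl, Finset.sum_eq_zero, add_zero]
    intro j _
    rw [if_neg (hγpos j).ne']
  have hFk : topComp F (γ k) = G k := by
    rw [hcomp _ (hγd k), if_neg (hγpos k).ne', zero_add, Finset.sum_eq_single k]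
    · simp
    · intro j _ hj
      rw [if_neg (fun h => hj (hmono.injective h))]
    · simp
  have hFi : ∀ i, 0 < i → i < γ k → i ∉ AddSubmonoid.closure (γ '' {j | j < k}) →
      topComp F i = 0 := by
    intro i hi hik his
    rw [hcomp _ (hik.le.trans (hγd k)), if_neg hi.ne', zero_add]
    refine Finset.sum_eq_zero fun j _ => if_neg ?_
    rintro rfl
    exact his (AddSubmonoid.subset_closure ⟨j, hmono.lt_iff_lt.mp hik, rfl⟩)
  have hFne : F ≠ 0 := by
    rintro rfl
    apply hFd0
    rw [← hF0]
    simp [topComp]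
  have hPne : P ≠ 0 := by rintro rfl; simp at hP0
  have hQne : Q ≠ 0 := by rintro rfl; simp at hQ; exact hFne hQ
  have hmul := topComp_mul P Q hPne hQne
  rw [← hQ] at hmul
  have hFdPQ : Fd = topComp P 0 * topComp Q 0 := by rw [← hF0, hmul]; simp
  have hp0 : topComp P 0 ≠ 0 := fun h => hFd0 (by rw [hFdPQ, h, zero_mul])
  have hq0 : topComp Q 0 ≠ 0 := fun h => hFd0 (by rw [hFdPQ, h, mul_zero])
  have hrel : IsRelPrime (topComp P 0) (topComp Q 0) := by
    rw [hFdPQ] at hsf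
    exact (squarefree_mul_iff.mp hsf).1
  -- only the extreme terms survive
  have hext : ∀ i, 0 < i → i ∉ AddSubmonoid.closure (γ '' {j | j < k}) →
      (∀ s < i, s ∉ AddSubmonoid.closure (γ '' {j | j < k}) → topComp P s = 0 ∧ topComp Q s = 0) →
      topComp F i = topComp P 0 * topComp Q i + topComp P i * topComp Q 0 := by
    intro i hi his hs
    rw [hmul, ← Finset.sum_subset (s₁ := {(0, i), (i, 0)}), Finset.sum_pair]
    · simp; omega
    · intro x hx
      simp only [Finset.mem_insert, Finset.mem_singleton] at hx
      rcases hx with rfl | rfl <;> simp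
    · rintro ⟨s, t⟩ hx hx'
      simp only [Finset.HasAntidiagonal.mem_antidiagonal] at hx
      simp only [Finset.mem_insert, Finset.mem_singleton, Prod.mk.injEq, not_or, not_and] at hx'
      have hsi : s < i := by
        rcases Nat.lt_or_ge s i with h | h
        · exact h
        · exact absurd (by omega) (hx'.2 (by omega))
      have hti : t < i := by
        rcases Nat.lt_or_ge t i with h | h
        · exact h
        · exact absurd (by omega) (hx'.1 (by omega))
      by_cases h1 : s ∈ AddSubmonoid.closure (γ '' {j | j < k})
      · by_cases h2 : t ∈ AddSubmonoid.closure (γ '' {j | j < k})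
        · exact absurd (hx ▸ add_mem h1 h2) his
        · simp [(hs t hti h2).2]
      · simp [(hs s hsi h1).1]
  have key : ∀ i < γ k, i ∉ AddSubmonoid.closure (γ '' {j | j < k}) →
      topComp P i = 0 ∧ topComp Q i = 0 := by
    intro i
    induction i using Nat.strong_induction_on with
    | _ i ih =>
      intro hik his
      have hi : 0 < i := by
        rcases Nat.eq_zero_or_pos i with rfl | h
        · exact absurd (zero_mem _) his
        · exact h
      have h := hext i hi his (fun s hs => ih s hs (hs.trans hik))
      rw [hFi i hi hik his] at h
      constructor
      · refine topComp_eq_zero P i hi hp0 (hrel.dvd_of_dvd_mul_right ⟨- topComp Q i, ?_⟩)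
        linear_combination -h
      · refine topComp_eq_zero Q i hi hq0 (hrel.symm.dvd_of_dvd_mul_left ⟨- topComp P i, ?_⟩)
        linear_combination -h
  have hfin := hext (γ k) (hγpos k) hspan key
  rw [hFk, topComp_gt P _ hlt, zero_mul, add_zero] at hfin
  have hu := hrp (topComp P 0) ⟨_, hFdPQ⟩ ⟨_, hfin⟩
  obtain ⟨c, hc⟩ := hu.exists_right_inv
  have hc0 : c ≠ 0 := by rintro rfl; simp at hc
  have h2 : (topComp P 0).totalDegree = P.totalDegree := by
    have := homogeneousComponent_isHomogeneous (P.totalDegree - 0) P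
    rw [← topComp_le P 0 (Nat.zero_le _)] at this
    exact this.totalDegree hp0
  have := congrArg totalDegree hc
  rw [totalDegree_mul_of_isDomain hp0 hc0, h2, totalDegree_one] at this
  omega
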